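/- If E is a uniform eidostate, then 𝕊(E) = log₂( Σ_{e ∈ E} 2^{𝕊(e)} ), where the sum runs over the states e contained in E. -/

import Mathlib

structure EidoSys where
  State : Type
  [decEq : DecidableEq State]
  Eido : Set (Finset State)
  pair : State → State → State
  Sim : Finset State → Finset State → Prop
  Arrow : Finset State → Finset State → Prop
  pair_inj : ∀ a b a' b', pair a b = pair a' b' → a = a' ∧ b = b'
  eido_nonempty : ∀ A ∈ Eido, A.Nonempty
  singleton_mem : ∀ a : State, ({a} : Finset State) ∈ Eido
  comb_mem : ∀ A B : Finset State, Finset.image₂ pair A B ∈ Eido ↔ A ∈ Eido ∧ B ∈ Eido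
  subset_mem : ∀ A B : Finset State, A ∈ Eido → B ⊆ A → B.Nonempty → B ∈ Eido
  sim_refl : ∀ A : Finset State, Sim A A
  sim_symm : ∀ A B : Finset State, Sim A B → Sim B A
  sim_trans : ∀ A B C : Finset State, Sim A B → Sim B C → Sim A C
  sim_comm : ∀ A B : Finset State, Sim (Finset.image₂ pair A B) (Finset.image₂ pair B A)
  sim_assoc : ∀ A B C : Finset State,
    Sim (Finset.image₂ pair (Finset.image₂ pair A B) C) (Finset.image₂ pair A (Finset.image₂ pair B C))
  sim_congr : ∀ A B C : Finset State, Sim A B → Sim (Finset.image₂ pair A C) (Finset.image₂ pair B C)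
  arrow_of_sim : ∀ A B : Finset State, A ∈ Eido → B ∈ Eido → Sim A B → Arrow A B
  arrow_trans : ∀ A B C : Finset State, Arrow A B → Arrow B C → Arrow A C
  arrow_comb : ∀ A B C : Finset State, Arrow A B → Arrow (Finset.image₂ pair A C) (Finset.image₂ pair B C)
  arrow_cancel : ∀ (A B : Finset State) (s : State),
    Arrow (Finset.image₂ pair A {s}) (Finset.image₂ pair B {s}) → Arrow A B
  arrow_nsubset : ∀ A B : Finset State, A ∈ Eido → B ∈ Eido → B ⊂ A → ¬ Arrow A B
  arrow_subset_single : ∀ (A A' : Finset State) (b : State),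
    A ∈ Eido → A' ⊆ A → A'.Nonempty → Arrow A {b} → Arrow A' {b}
  arrow_union : ∀ A₁ A₂ B₁ B₂ : Finset State,
    A₁ ∈ Eido → A₂ ∈ Eido → B₁ ∈ Eido → B₂ ∈ Eido →
    Disjoint A₁ A₂ → Disjoint B₁ B₂ →
    (∀ a ∈ A₁ ∪ A₂, ∀ b ∈ A₁ ∪ A₂, Arrow {a} {b} ∨ Arrow {b} {a}) →
    (∀ a ∈ B₁ ∪ B₂, ∀ b ∈ B₁ ∪ B₂, Arrow {a} {b} ∨ Arrow {b} {a}) →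
    Arrow A₁ B₁ → Arrow A₂ B₂ → Arrow (A₁ ∪ A₂) (B₁ ∪ B₂)

attribute [instance] EidoSys.decEq

namespace EidoSys

variable (S : EidoSys)

/-- Combination of eidostates: the Cartesian product, realized via the pairing map. -/
def comb (A B : Finset S.State) : Finset S.State := Finset.image₂ S.pair A B

/-- The process (A,B) is possible: A ⇌ B. -/
def Pos (A B : Finset S.State) : Prop := S.Arrow A B ∨ S.Arrow B A

/-- A ↔ B. -/
def Rev (A B : Finset S.State) : Prop := S.Arrow A B ∧ S.Arrow B A

/-- Uniform eidostate. -/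
def Uniform (A : Finset S.State) : Prop := A ∈ S.Eido ∧ ∀ a ∈ A, ∀ b ∈ A, S.Pos {a} {b}

/-- Record state: a ↔ a + r for some state a. -/
def IsRecord (r : S.State) : Prop := ∃ a : S.State, S.Rev {a} (S.comb {a} {r})

/-- Information state: an eidostate all of whose elements are record states. -/
def IsInfo (I : Finset S.State) : Prop := I ∈ S.Eido ∧ ∀ r ∈ I, S.IsRecord r

/-- Bit state: an information state with exactly two elements. -/
def IsBit (I : Finset S.State) : Prop := S.IsInfo I ∧ I.card = 2

/-- Information axiom: there exist a bit state and a possible bit process. -/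
def InfoAxiom : Prop := ∃ (r : S.State) (I : Finset S.State), S.IsRecord r ∧ S.IsBit I ∧ S.Pos {r} I

/-- Demon axiom. -/
def DemonAxiom : Prop := ∀ a b : S.State, ∀ J : Finset S.State, S.IsInfo J →
    S.Arrow {a} (S.comb {b} J) →
    (∃ I : Finset S.State, S.IsInfo I ∧ S.Arrow {b} (S.comb {a} I)) ∧
    (∀ I : Finset S.State, S.IsInfo I → S.Arrow {a} (S.comb {b} I) ∨ S.Arrow (S.comb {b} I) {a})

/-- `copies A n` is the combination of `n+1` copies of `A` (so `copies A 0 = A`). -/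
def copies (A : Finset S.State) : ℕ → Finset S.State
  | 0 => A
  | n + 1 => S.comb A (copies A n)

/-- Stability axiom: if nA → nB + J for arbitrarily large n, then A → B. -/
def StabilityAxiom : Prop := ∀ A B J : Finset S.State, A ∈ S.Eido → B ∈ S.Eido → S.IsInfo J →
    (∀ N : ℕ, ∃ n ≥ N, S.Arrow (S.copies A n) (S.comb (S.copies B n) J)) → S.Arrow A B

/-- State-equivalence axiom. -/
def StateEquivAxiom : Prop := ∀ E : Finset S.State, S.Uniform E →
    ∃ e x y : S.State, S.Arrow {x} {y} ∧ S.Rev (S.comb E {x}) (S.comb {e} {y})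

/-- `addCopies A B k` is A + k·B (k copies of B appended to A). -/
def addCopies (A B : Finset S.State) : ℕ → Finset S.State
  | 0 => A
  | k + 1 => S.comb (addCopies A B k) B

/-- A designated set of mechanical states. -/
def MechSet (M : Set S.State) : Prop :=
  (∀ l ∈ M, ∀ m ∈ M, S.pair l m ∈ M) ∧
  (∀ l ∈ M, ∀ m ∈ M, S.Arrow {l} {m} → S.Arrow {m} {l})

/-- Component of content on uniform eidostates. -/
def IsCoCU (Q : Finset S.State → ℝ) : Prop :=
  (∀ E F : Finset S.State, S.Uniform E → S.Uniform F → Q (S.comb E F) = Q E + Q F) ∧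
  (∀ E F : Finset S.State, S.Uniform E → S.Uniform F → S.Pos E F → Q E = Q F)

/-- Entropy function on the uniform eidostates (relative to mechanical states M). -/
def IsEntropyU (M : Set S.State) (Ent : Finset S.State → ℝ) : Prop :=
  (∀ E F : Finset S.State, S.Uniform E → S.Uniform F → Ent (S.comb E F) = Ent E + Ent F) ∧
  (∀ E F : Finset S.State, S.Uniform E → S.Uniform F → S.Pos E F → (S.Arrow E F ↔ Ent E ≤ Ent F)) ∧
  (∀ m ∈ M, Ent {m} = 0) ∧
  (∀ I : Finset S.State, S.IsInfo I → Ent I = Real.logb 2 (I.card))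

end EidoSys

namespace EidoSys

variable {S : EidoSys}

lemma comb_singleton (a b : S.State) : S.comb {a} {b} = {S.pair a b} := by
  simp [comb]

lemma card_comb (A B : Finset S.State) : (S.comb A B).card = A.card * B.card :=
  Finset.card_image₂_iff.2 <| Function.Injective.injOn fun _ _ h =>
    Prod.ext (S.pair_inj _ _ _ _ h).1 (S.pair_inj _ _ _ _ h).2

lemma arrow_refl {A : Finset S.State} (hA : A ∈ S.Eido) : S.Arrow A A :=
  S.arrow_of_sim _ _ hA hA (S.sim_refl A)

lemma arrow_pair_comm (a b : S.State) : S.Arrow {S.pair a b} {S.pair b a} := by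
  have h := S.sim_comm {a} {b}
  simp only [Finset.image₂_singleton] at h
  exact S.arrow_of_sim _ _ (S.singleton_mem _) (S.singleton_mem _) h

lemma rev_pair_assoc (a b c : S.State) :
    S.Rev {S.pair (S.pair a b) c} {S.pair a (S.pair b c)} := by
  have h := S.sim_assoc {a} {b} {c}
  simp only [Finset.image₂_singleton] at h
  exact ⟨S.arrow_of_sim _ _ (S.singleton_mem _) (S.singleton_mem _) h,
    S.arrow_of_sim _ _ (S.singleton_mem _) (S.singleton_mem _) (S.sim_symm _ _ h)⟩

lemma rev_pair_comm (a b : S.State) : S.Rev {S.pair a b} {S.pair b a} :=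
  ⟨arrow_pair_comm a b, arrow_pair_comm b a⟩

lemma Rev.symm {A B : Finset S.State} (h : S.Rev A B) : S.Rev B A := ⟨h.2, h.1⟩

lemma Rev.trans {A B C : Finset S.State} (h : S.Rev A B) (h' : S.Rev B C) : S.Rev A C :=
  ⟨S.arrow_trans _ _ _ h.1 h'.1, S.arrow_trans _ _ _ h'.2 h.2⟩

lemma Rev.pair_right {a b : S.State} (h : S.Rev {a} {b}) (c : S.State) :
    S.Rev {S.pair a c} {S.pair b c} := by
  simpa only [Finset.image₂_singleton, Rev] using
    And.intro (S.arrow_comb _ _ {c} h.1) (S.arrow_comb _ _ {c} h.2)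

lemma Rev.pair_left {a b : S.State} (h : S.Rev {a} {b}) (c : S.State) :
    S.Rev {S.pair c a} {S.pair c b} :=
  (rev_pair_comm c a).trans ((h.pair_right c).trans (rev_pair_comm b c))

lemma Rev.of_pair_right {a b c : S.State} (h : S.Rev {S.pair a c} {S.pair b c}) :
    S.Rev {a} {b} := by
  simp only [Rev, ← Finset.image₂_singleton (f := S.pair)] at h
  exact ⟨S.arrow_cancel _ _ c h.1, S.arrow_cancel _ _ c h.2⟩

lemma isRecord_iff {r : S.State} : S.IsRecord r ↔ ∃ a, S.Rev {a} {S.pair a r} := by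
  simp only [IsRecord, comb_singleton]

/-- Any two record states are interconvertible. -/
lemma IsRecord.rev {r s : S.State} (hr : S.IsRecord r) (hs : S.IsRecord s) :
    S.Rev {r} {s} := by
  obtain ⟨a, ha⟩ := isRecord_iff.1 hr
  obtain ⟨b, hb⟩ := isRecord_iff.1 hs
  have h₁ : S.Rev {S.pair r (S.pair a b)} {S.pair a b} :=
    (rev_pair_assoc r a b).symm.trans
      (((rev_pair_comm r a).trans ha.symm).pair_right b)
  have h₂ : S.Rev {S.pair s (S.pair a b)} {S.pair a b} :=
    (rev_pair_comm _ _).trans ((rev_pair_assoc a b s).trans (hb.symm.pair_left a))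
  exact (h₁.trans h₂.symm).of_pair_right

lemma IsRecord.pair {r s : S.State} (hr : S.IsRecord r) (hs : S.IsRecord s) :
    S.IsRecord (S.pair r s) := by
  obtain ⟨a, ha⟩ := isRecord_iff.1 hr
  have has : S.Rev {a} {S.pair a s} := ha.trans ((hr.rev hs).pair_left a)
  exact isRecord_iff.2 ⟨a, has.trans ((ha.pair_right s).trans (rev_pair_assoc a r s))⟩

lemma uniform_singleton (a : S.State) : S.Uniform {a} := by
  refine ⟨S.singleton_mem a, ?_⟩
  simp only [Finset.mem_singleton]
  rintro _ rfl _ rfl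
  exact Or.inl (arrow_refl (S.singleton_mem _))

lemma IsInfo.uniform {I : Finset S.State} (hI : S.IsInfo I) : S.Uniform I :=
  ⟨hI.1, fun a ha b hb => Or.inl ((hI.2 a ha).rev (hI.2 b hb)).1⟩

lemma Uniform.subset {A B : Finset S.State} (hA : S.Uniform A) (h : B ⊆ A) (hB : B.Nonempty) :
    S.Uniform B :=
  ⟨S.subset_mem A B hA.1 h hB, fun a ha b hb => hA.2 a (h ha) b (h hb)⟩

lemma IsInfo.subset {A B : Finset S.State} (hA : S.IsInfo A) (h : B ⊆ A) (hB : B.Nonempty) :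
    S.IsInfo B :=
  ⟨S.subset_mem A B hA.1 h hB, fun r hr => hA.2 r (h hr)⟩

lemma IsInfo.comb {I J : Finset S.State} (hI : S.IsInfo I) (hJ : S.IsInfo J) :
    S.IsInfo (S.comb I J) := by
  refine ⟨(S.comb_mem I J).2 ⟨hI.1, hJ.1⟩, fun r hr => ?_⟩
  obtain ⟨a, ha, b, hb, rfl⟩ := Finset.mem_image₂.1 hr
  exact (hI.2 a ha).pair (hJ.2 b hb)

/-- The information axiom provides information states of every positive cardinality. -/
lemma InfoAxiom.exists_isInfo_card (h : S.InfoAxiom) {n : ℕ} (hn : 0 < n) :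
    ∃ I, S.IsInfo I ∧ I.card = n := by
  obtain ⟨_, B, -, ⟨hB, hB2⟩, -⟩ := h
  have key : ∀ k : ℕ, ∃ I, S.IsInfo I ∧ I.card = 2 ^ (k + 1) := by
    intro k
    induction k with
    | zero => exact ⟨B, hB, by simpa using hB2⟩
    | succ k ih =>
      obtain ⟨I, hI, hc⟩ := ih
      exact ⟨S.comb I B, hI.comb hB, by rw [card_comb, hc, hB2, pow_succ 2 (k + 1)]⟩
  obtain ⟨I, hI, hc⟩ := key n
  obtain ⟨J, hJI, hJ⟩ := Finset.exists_subset_card_eq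
    (show n ≤ I.card from hc ▸ (n.lt_succ_self.trans Nat.lt_two_pow_self).le)
  exact ⟨J, hI.subset hJI (Finset.card_pos.1 (hJ ▸ hn)), hJ⟩

/-- A record state can be turned into any two-element information state. -/
lemma InfoAxiom.arrow_of_card_two (h : S.InfoAxiom) {r : S.State} (hr : S.IsRecord r)
    {I : Finset S.State} (hI : S.IsInfo I) (hc : I.card = 2) : S.Arrow {r} I := by
  obtain ⟨t, B, ht, ⟨hB, hB2⟩, hpos⟩ := h
  obtain ⟨a, b, hab, rfl⟩ := Finset.card_eq_two.1 hB2
  obtain ⟨c, d, hcd, rfl⟩ := Finset.card_eq_two.1 hc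
  have ha : S.IsRecord a := hB.2 a (by simp)
  have hb : S.IsRecord b := hB.2 b (by simp)
  have hc' : S.IsRecord c := hI.2 c (by simp)
  have hd : S.IsRecord d := hI.2 d (by simp)
  have hBI : S.Arrow {a, b} {c, d} :=
    S.arrow_union {a} {b} {c} {d} (S.singleton_mem a) (S.singleton_mem b) (S.singleton_mem c)
      (S.singleton_mem d) (by simpa using hab) (by simpa using hcd)
      hB.uniform.2 hI.uniform.2 (ha.rev hc').1 (hb.rev hd).1
  have htB : S.Arrow {t} {a, b} := by
    refine hpos.resolve_right fun hbt => ?_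
    refine S.arrow_nsubset _ {a} hB.1 (S.singleton_mem a) ?_ (S.arrow_trans _ _ _ hbt (ht.rev ha).1)
    refine Finset.ssubset_iff_subset_ne.2 ⟨by simp, fun he => ?_⟩
    have := congrArg Finset.card he
    rw [hB2] at this
    simp at this
  exact S.arrow_trans _ _ _ (hr.rev ht).1 (S.arrow_trans _ _ _ htB hBI)

/-- A record state can be turned into any information state. -/
lemma InfoAxiom.arrow_isInfo (h : S.InfoAxiom) {I : Finset S.State} (hI : S.IsInfo I) :
    ∀ r, S.IsRecord r → S.Arrow {r} I := by
  induction I using Finset.induction_on with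
  | empty => exact absurd (S.eido_nonempty _ hI.1) (by simp)
  | insert a J ha ih =>
    intro r hr
    have har : S.IsRecord a := hI.2 a (by simp)
    rcases J.eq_empty_or_nonempty with rfl | hJ
    · simpa using (hr.rev har).1
    · have hJI : S.IsInfo J := hI.subset (Finset.subset_insert a J) hJ
      obtain ⟨b, hb⟩ := hJ
      have hbr : S.IsRecord b := hJI.2 b hb
      have hab : a ≠ b := by rintro rfl; exact ha hb
      have hpair : S.IsInfo {a, b} :=
        hI.subset (by simp [Finset.insert_subset_iff, hb]) (by simp)
      refine S.arrow_trans _ _ _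
        (h.arrow_of_card_two hr hpair (Finset.card_pair hab)) ?_
      exact S.arrow_union {a} {b} {a} J (S.singleton_mem a) (S.singleton_mem b)
        (S.singleton_mem a) hJI.1 (by simpa using hab) (by simpa using ha)
        hpair.uniform.2 hI.uniform.2 (arrow_refl (S.singleton_mem a)) (ih hJI b hbr)

lemma IsCoCU.eq_zero_of_isRecord {Q : Finset S.State → ℝ} (hQ : S.IsCoCU Q) {r : S.State}
    (hr : S.IsRecord r) : Q {r} = 0 := by
  obtain ⟨a, ha⟩ := hr
  have h₁ := hQ.1 _ _ (uniform_singleton a) (uniform_singleton r)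
  have h₂ := hQ.2 {a} (S.comb {a} {r}) (uniform_singleton a)
    (by rw [comb_singleton]; exact uniform_singleton _) (Or.inl ha.1)
  linarith

lemma IsCoCU.eq_zero_of_isInfo {Q : Finset S.State → ℝ} (hQ : S.IsCoCU Q) (h : S.InfoAxiom)
    {I : Finset S.State} (hI : S.IsInfo I) : Q I = 0 := by
  obtain ⟨r, hr⟩ := S.eido_nonempty I hI.1
  rw [← hQ.eq_zero_of_isRecord (hI.2 r hr)]
  exact (hQ.2 _ _ (uniform_singleton r) hI.uniform
    (Or.inl (h.arrow_isInfo hI r (hI.2 r hr)))).symm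

/-- Eidostates with equal components of content are related by a possible process. -/
def ContentDetermines (S : EidoSys) : Prop :=
  ∀ E F : Finset S.State, S.Uniform E → S.Uniform F →
    (∀ Q : Finset S.State → ℝ, S.IsCoCU Q → Q E = Q F) → S.Pos E F

lemma ContentDetermines.uniform_comb (hcomp : S.ContentDetermines) {A B : Finset S.State}
    (hA : S.Uniform A) (hB : S.Uniform B) : S.Uniform (S.comb A B) := by
  refine ⟨(S.comb_mem A B).2 ⟨hA.1, hB.1⟩, fun x hx y hy => ?_⟩
  obtain ⟨a, ha, b, hb, rfl⟩ := Finset.mem_image₂.1 hx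
  obtain ⟨a', ha', b', hb', rfl⟩ := Finset.mem_image₂.1 hy
  refine hcomp _ _ (uniform_singleton _) (uniform_singleton _) fun Q hQ => ?_
  rw [← comb_singleton, ← comb_singleton,
    hQ.1 _ _ (uniform_singleton _) (uniform_singleton _),
    hQ.1 _ _ (uniform_singleton _) (uniform_singleton _),
    hQ.2 _ _ (uniform_singleton a) (uniform_singleton a') (hA.2 a ha a' ha'),
    hQ.2 _ _ (uniform_singleton b) (uniform_singleton b') (hB.2 b hb b' hb')]

lemma disjoint_comb_left {A B : Finset S.State} (h : Disjoint A B) (C D : Finset S.State) :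
    Disjoint (S.comb A C) (S.comb B D) := by
  rw [Finset.disjoint_left] at h ⊢
  intro x hx hy
  obtain ⟨a, ha, c, -, rfl⟩ := Finset.mem_image₂.1 hx
  obtain ⟨b, hb, d, -, hbd⟩ := Finset.mem_image₂.1 hy
  exact h ha ((S.pair_inj _ _ _ _ hbd).1 ▸ hb)

lemma disjoint_comb_right {A B : Finset S.State} (h : Disjoint A B) (C D : Finset S.State) :
    Disjoint (S.comb C A) (S.comb D B) := by
  rw [Finset.disjoint_left] at h ⊢
  intro x hx hy
  obtain ⟨c, -, a, ha, rfl⟩ := Finset.mem_image₂.1 hx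
  obtain ⟨d, -, b, hb, hbd⟩ := Finset.mem_image₂.1 hy
  exact h ha ((S.pair_inj _ _ _ _ hbd).2 ▸ hb)

lemma comb_union_left (A B C : Finset S.State) :
    S.comb (A ∪ B) C = S.comb A C ∪ S.comb B C :=
  Finset.image₂_union_left

lemma comb_union_right (A B C : Finset S.State) :
    S.comb A (B ∪ C) = S.comb A B ∪ S.comb A C :=
  Finset.image₂_union_right

/-- If `R` is compatible with disjoint unions of uniform eidostates, then `R (e + I) (f + J)` for
each `e ∈ E` and each `J` of size `k e` implies `R (E + I) (f + J)` for `J` of the total size. -/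
lemma rel_comb_of_forall_mem {R : Finset S.State → Finset S.State → Prop}
    (hR : ∀ A₁ A₂ B₁ B₂ : Finset S.State, Disjoint A₁ A₂ → Disjoint B₁ B₂ →
      A₁ ∈ S.Eido → A₂ ∈ S.Eido → B₁ ∈ S.Eido → B₂ ∈ S.Eido →
      S.Uniform (A₁ ∪ A₂) → S.Uniform (B₁ ∪ B₂) → R A₁ B₁ → R A₂ B₂ → R (A₁ ∪ A₂) (B₁ ∪ B₂))
    (hcomp : S.ContentDetermines) {E I : Finset S.State} (f : S.State) (hE : S.Uniform E)
    (hI : S.IsInfo I) (k : S.State → ℕ) (hk : ∀ e ∈ E, 0 < k e)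
    (h : ∀ e ∈ E, ∀ J, S.IsInfo J → J.card = k e → R (S.comb {e} I) (S.comb {f} J))
    {J : Finset S.State} (hJ : S.IsInfo J) (hc : J.card = ∑ e ∈ E, k e) :
    R (S.comb E I) (S.comb {f} J) := by
  induction E using Finset.induction_on generalizing J with
  | empty => exact absurd (S.eido_nonempty _ hE.1) (by simp)
  | insert a E ha ih =>
    rcases E.eq_empty_or_nonempty with rfl | hne
    · exact h a (by simp) J hJ (by simpa using hc)
    · rw [Finset.sum_insert ha] at hc
      have hE' := hE.subset (Finset.subset_insert a E) hne
      obtain ⟨K, hKJ, hK⟩ := Finset.exists_subset_card_eq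
        (show k a ≤ J.card from hc ▸ Nat.le_add_right _ _)
      have hKI : S.IsInfo K :=
        hJ.subset hKJ (Finset.card_pos.1 (hK ▸ hk a (Finset.mem_insert_self a E)))
      have hLc : (J \ K).card = ∑ e ∈ E, k e := by
        rw [Finset.card_sdiff_of_subset hKJ, hc, hK, Nat.add_sub_cancel_left]
      have hLI : S.IsInfo (J \ K) := hJ.subset Finset.sdiff_subset <| Finset.card_pos.1 <|
        hLc ▸ Finset.sum_pos (fun e he => hk e (Finset.mem_insert_of_mem he)) hne
      have hU := hcomp.uniform_comb hE hI.uniform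
      have hV := hcomp.uniform_comb (uniform_singleton f) hJ.uniform
      rw [← Finset.union_sdiff_of_subset hKJ, comb_union_right] at hV ⊢
      rw [Finset.insert_eq, comb_union_left] at hU ⊢
      refine hR _ _ _ _ (disjoint_comb_left (by simpa using ha) _ _)
        (disjoint_comb_right Finset.disjoint_sdiff _ _)
        ((S.comb_mem _ _).2 ⟨S.singleton_mem a, hI.1⟩) ((S.comb_mem _ _).2 ⟨hE'.1, hI.1⟩)
        ((S.comb_mem _ _).2 ⟨S.singleton_mem f, hKI.1⟩)
        ((S.comb_mem _ _).2 ⟨S.singleton_mem f, hLI.1⟩) hU hV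
        (h a (by simp) K hKI hK)
        (ih hE' (fun e he => hk e (Finset.mem_insert_of_mem he))
          (fun e he => h e (Finset.mem_insert_of_mem he)) hLI hLc)

section Entropy

variable {M : Set S.State} {Ent : Finset S.State → ℝ}

lemma IsEntropyU.two_rpow_comb (hEnt : S.IsEntropyU M Ent) {A I : Finset S.State}
    (hA : S.Uniform A) (hI : S.IsInfo I) :
    (2 : ℝ) ^ Ent (S.comb A I) = 2 ^ Ent A * I.card := by
  have hpos : (0 : ℝ) < I.card :=
    Nat.cast_pos.2 (Finset.card_pos.2 (S.eido_nonempty I hI.1))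
  rw [hEnt.1 _ _ hA hI.uniform, hEnt.2.2.2 I hI, Real.rpow_add two_pos,
    Real.rpow_logb two_pos (by norm_num) hpos]

lemma IsEntropyU.two_rpow_le (hEnt : S.IsEntropyU M Ent) {A B : Finset S.State}
    (hA : S.Uniform A) (hB : S.Uniform B) (h : S.Arrow A B) :
    (2 : ℝ) ^ Ent A ≤ 2 ^ Ent B :=
  Real.rpow_le_rpow_of_exponent_le one_le_two ((hEnt.2.1 A B hA hB (Or.inl h)).1 h)

lemma IsEntropyU.arrow_of_two_rpow_le (hEnt : S.IsEntropyU M Ent) {A B : Finset S.State}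
    (hA : S.Uniform A) (hB : S.Uniform B) (hAB : S.Pos A B)
    (h : (2 : ℝ) ^ Ent A ≤ 2 ^ Ent B) : S.Arrow A B :=
  (hEnt.2.1 A B hA hB hAB).2 ((Real.rpow_le_rpow_left_iff one_lt_two).1 h)

lemma pos_comb_isInfo (hinfo : S.InfoAxiom) (hcomp : S.ContentDetermines) {A B I J : Finset S.State}
    (hA : S.Uniform A) (hB : S.Uniform B) (hAB : S.Pos A B) (hI : S.IsInfo I) (hJ : S.IsInfo J) :
    S.Pos (S.comb A I) (S.comb B J) := by
  refine hcomp _ _ (hcomp.uniform_comb hA hI.uniform) (hcomp.uniform_comb hB hJ.uniform)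
    fun Q hQ => ?_
  rw [hQ.1 _ _ hA hI.uniform, hQ.1 _ _ hB hJ.uniform, hQ.eq_zero_of_isInfo hinfo hI,
    hQ.eq_zero_of_isInfo hinfo hJ, hQ.2 _ _ hA hB hAB]

lemma IsEntropyU.two_rpow_mul_le (hinfo : S.InfoAxiom) (hcomp : S.ContentDetermines)
    (hEnt : S.IsEntropyU M Ent) {E : Finset S.State} (hE : S.Uniform E) {f : S.State}
    (hf : f ∈ E) {n : ℕ} (hn : 0 < n) (k : S.State → ℕ) (hk : ∀ e ∈ E, 0 < k e)
    (h : ∀ e ∈ E, (2 : ℝ) ^ Ent {e} * n ≤ 2 ^ Ent {f} * k e) :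
    (2 : ℝ) ^ Ent E * n ≤ 2 ^ Ent {f} * ((∑ e ∈ E, k e : ℕ) : ℝ) := by
  obtain ⟨I, hI, rfl⟩ := hinfo.exists_isInfo_card hn
  obtain ⟨J, hJ, hJc⟩ := hinfo.exists_isInfo_card (Finset.sum_pos hk ⟨f, hf⟩)
  have hu := uniform_singleton (S := S)
  rw [← hJc, ← hEnt.two_rpow_comb hE hI, ← hEnt.two_rpow_comb (hu f) hJ]
  refine hEnt.two_rpow_le (hcomp.uniform_comb hE hI.uniform)
    (hcomp.uniform_comb (hu f) hJ.uniform) ?_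
  refine rel_comb_of_forall_mem (R := S.Arrow)
    (fun A₁ A₂ B₁ B₂ hA hB h₁ h₂ h₃ h₄ hUA hUB =>
      S.arrow_union A₁ A₂ B₁ B₂ h₁ h₂ h₃ h₄ hA hB hUA.2 hUB.2)
    hcomp f hE hI k hk (fun e he K hK hKc => ?_) hJ hJc
  refine hEnt.arrow_of_two_rpow_le (hcomp.uniform_comb (hu e) hI.uniform)
    (hcomp.uniform_comb (hu f) hK.uniform)
    (pos_comb_isInfo hinfo hcomp (hu e) (hu f) (hE.2 e he f hf) hI hK) ?_
  rw [hEnt.two_rpow_comb (hu e) hI, hEnt.two_rpow_comb (hu f) hK, hKc]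
  exact h e he

lemma IsEntropyU.le_two_rpow_mul (hinfo : S.InfoAxiom) (hcomp : S.ContentDetermines)
    (hEnt : S.IsEntropyU M Ent) {E : Finset S.State} (hE : S.Uniform E) {f : S.State}
    (hf : f ∈ E) {n : ℕ} (hn : 0 < n) (k : S.State → ℕ) (hk : ∀ e ∈ E, 0 < k e)
    (h : ∀ e ∈ E, (2 : ℝ) ^ Ent {f} * k e ≤ 2 ^ Ent {e} * n) :
    (2 : ℝ) ^ Ent {f} * ((∑ e ∈ E, k e : ℕ) : ℝ) ≤ 2 ^ Ent E * n := by
  obtain ⟨I, hI, rfl⟩ := hinfo.exists_isInfo_card hn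
  obtain ⟨J, hJ, hJc⟩ := hinfo.exists_isInfo_card (Finset.sum_pos hk ⟨f, hf⟩)
  have hu := uniform_singleton (S := S)
  rw [← hJc, ← hEnt.two_rpow_comb hE hI, ← hEnt.two_rpow_comb (hu f) hJ]
  refine hEnt.two_rpow_le (hcomp.uniform_comb (hu f) hJ.uniform)
    (hcomp.uniform_comb hE hI.uniform) ?_
  refine rel_comb_of_forall_mem (R := fun A B => S.Arrow B A)
    (fun A₁ A₂ B₁ B₂ hA hB h₁ h₂ h₃ h₄ hUA hUB =>
      S.arrow_union B₁ B₂ A₁ A₂ h₃ h₄ h₁ h₂ hB hA hUB.2 hUA.2)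
    hcomp f hE hI k hk (fun e he K hK hKc => ?_) hJ hJc
  refine hEnt.arrow_of_two_rpow_le (hcomp.uniform_comb (hu f) hK.uniform)
    (hcomp.uniform_comb (hu e) hI.uniform)
    (pos_comb_isInfo hinfo hcomp (hu f) (hu e) (hE.2 f hf e he) hK hI) ?_
  rw [hEnt.two_rpow_comb (hu e) hI, hEnt.two_rpow_comb (hu f) hK, hKc]
  exact h e he

lemma le_of_forall_ge_mul_le_mul_add {x y c : ℝ} (N : ℕ)
    (h : ∀ n : ℕ, N ≤ n → x * n ≤ y * n + c) : x ≤ y := by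
  by_contra! hxy
  obtain ⟨n, hn⟩ := exists_nat_gt (c / (x - y))
  have h₁ := h (max N n) (le_max_left _ _)
  have h₂ : c / (x - y) < ((max N n : ℕ) : ℝ) :=
    hn.trans_le (Nat.cast_le.2 (le_max_right _ _))
  rw [div_lt_iff₀ (sub_pos.2 hxy)] at h₂
  linarith

lemma IsEntropyU.two_rpow_eq_sum (hinfo : S.InfoAxiom) (hcomp : S.ContentDetermines)
    (hEnt : S.IsEntropyU M Ent) {E : Finset S.State} (hE : S.Uniform E) :
    (2 : ℝ) ^ Ent E = ∑ e ∈ E, (2 : ℝ) ^ Ent {e} := by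
  obtain ⟨f, hf⟩ := S.eido_nonempty E hE.1
  set w : S.State → ℝ := fun e => (2 : ℝ) ^ Ent {e} with hw
  have hwpos : ∀ e, 0 < w e := fun e => Real.rpow_pos_of_pos two_pos _
  have hdiv : ∀ (n : ℕ) e, w f * (w e * n / w f) = w e * n := fun n e =>
    mul_div_cancel₀ _ (hwpos f).ne'
  have hsum : ∀ n : ℕ, (∑ e ∈ E, w e) * n = w f * ∑ e ∈ E, w e * n / w f := fun n => by
    simp only [Finset.mul_sum, Finset.sum_mul, hdiv]
  apply le_antisymm
  · refine le_of_forall_ge_mul_le_mul_add (c := w f * E.card) 1 fun n hn => ?_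
    have hn' : (0 : ℝ) < n := Nat.cast_pos.2 hn
    refine (hEnt.two_rpow_mul_le hinfo hcomp hE hf hn (fun e => ⌈w e * n / w f⌉₊)
      (fun e _ => Nat.ceil_pos.2 (div_pos (mul_pos (hwpos e) hn') (hwpos f))) fun e _ => ?_).trans ?_
    · exact (hdiv n e).symm.le.trans
        (mul_le_mul_of_nonneg_left (Nat.le_ceil _) (hwpos f).le)
    · rw [hsum, ← mul_add]
      refine mul_le_mul_of_nonneg_left ?_ (hwpos f).le
      rw [Nat.cast_sum, Finset.cast_card, ← Finset.sum_add_distrib]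
      exact Finset.sum_le_sum fun e _ =>
        (Nat.ceil_lt_add_one (div_pos (mul_pos (hwpos e) hn') (hwpos f)).le).le
  · obtain ⟨N, hN⟩ : ∃ N : ℕ, ∀ e ∈ E, w f / w e ≤ N := by
      obtain ⟨N, hN⟩ := exists_nat_ge (∑ e ∈ E, w f / w e)
      exact ⟨N, fun e he => (Finset.single_le_sum
        (fun e _ => (div_pos (hwpos f) (hwpos e)).le) he).trans hN⟩
    refine le_of_forall_ge_mul_le_mul_add (c := w f * E.card) (N + 1) fun n hn => ?_
    have hn' : 0 < n := by omega
    have hone : ∀ e ∈ E, 1 ≤ w e * n / w f := fun e he => by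
      have : w f / w e ≤ n := (hN e he).trans (Nat.cast_le.2 (by omega))
      rw [div_le_iff₀ (hwpos e)] at this
      rw [le_div_iff₀ (hwpos f)]
      linarith
    have key := hEnt.le_two_rpow_mul hinfo hcomp hE hf hn' (fun e => ⌊w e * n / w f⌋₊)
      (fun e he => Nat.floor_pos.2 (hone e he)) fun e he =>
        (mul_le_mul_of_nonneg_left (Nat.floor_le (zero_le_one.trans (hone e he)))
          (hwpos f).le).trans (hdiv n e).le
    refine le_trans ?_ (add_le_add_left key _)
    rw [hsum, ← mul_add]
    refine mul_le_mul_of_nonneg_left ?_ (hwpos f).le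
    rw [Nat.cast_sum, Finset.cast_card, ← Finset.sum_add_distrib]
    exact Finset.sum_le_sum fun e _ => (Nat.lt_floor_add_one _).le

end Entropy

end EidoSys

/-- If E is a uniform eidostate, then 𝕊(E) = log₂( Σ_{e ∈ E} 2^𝕊(e) ). -/
theorem stmt14 (S : EidoSys) (hinfo : S.InfoAxiom) (hdemon : S.DemonAxiom)
    (hstab : S.StabilityAxiom) (hse : S.StateEquivAxiom)
    (M : Set S.State) (hM : S.MechSet M)
    (Ent : Finset S.State → ℝ) (hEnt : S.IsEntropyU M Ent)
    (hcomp : ∀ E F : Finset S.State, S.Uniform E → S.Uniform F →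
      (∀ Q : Finset S.State → ℝ, S.IsCoCU Q → Q E = Q F) → S.Pos E F)
    (E : Finset S.State) (hE : S.Uniform E) :
    Ent E = Real.logb 2 (∑ e ∈ E, (2 : ℝ) ^ (Ent {e})) := by
  rw [← hEnt.two_rpow_eq_sum hinfo hcomp hE, Real.logb_rpow two_pos (by norm_num)]
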